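/- arXiv:1411.1752 — 7 statements merged into one kernel-verified Lean document; each statement's English description precedes it below -/
import Mathlib

section
/- Let N and M be integers with 1 ≤ M ≤ N and let ε be a real number with 0 ≤ ε ≤ 1. There exists a set function F on the subsets of a ground set V of size N that is normalized, monotone nondecreasing, and submodular, such that the expected value of F over a subset S of size M chosen uniformly at random satisfies E[F(S)] ≤ (M/N + ε/M) · max_{|S| ≤ M} F(S). -/
open Finset

/-- The number of `M`-subsets of `Fin N` containing a fixed element. -/
theorem card_powersetCard_mem_aux (n m : ℕ) (v : Fin (n + 1)) :
    ((Finset.powersetCard (m + 1) (Finset.univ : Finset (Fin (n + 1)))).filter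
      (fun S => v ∈ S)).card = n.choose m := by
  have h : (Finset.powersetCard (m + 1) (Finset.univ : Finset (Fin (n + 1)))).filter
      (fun S => v ∈ S) =
      (Finset.powersetCard m ((Finset.univ : Finset (Fin (n + 1))).erase v)).image
        (fun S => insert v S) := by
    ext S
    simp only [Finset.mem_filter, Finset.mem_powersetCard, Finset.mem_image]
    constructor
    · rintro ⟨⟨_, hc⟩, hv⟩
      refine ⟨S.erase v, ⟨Finset.erase_subset_erase v (Finset.subset_univ S), ?_⟩,
        Finset.insert_erase hv⟩
      rw [Finset.card_erase_of_mem hv, hc]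
      rfl
    · rintro ⟨T, ⟨hT, hc⟩, rfl⟩
      have hv : v ∉ T := fun h => by simpa using hT h
      exact ⟨⟨Finset.subset_univ _, by rw [Finset.card_insert_of_notMem hv, hc]⟩,
        Finset.mem_insert_self v T⟩
  rw [h, Finset.card_image_of_injOn, Finset.card_powersetCard,
    Finset.card_erase_of_mem (Finset.mem_univ v)]
  · simp
  · intro S hS T hT hST
    have hS' : v ∉ S := fun h => by
      simpa using (Finset.mem_powersetCard.1 (Finset.mem_coe.1 hS)).1 h
    have hT' : v ∉ T := fun h => by
      simpa using (Finset.mem_powersetCard.1 (Finset.mem_coe.1 hT)).1 h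
    have := congrArg (fun X => Finset.erase X v) hST
    simpa [Finset.erase_insert hS', Finset.erase_insert hT'] using this

/-- For any `0 ≤ ε ≤ 1`, there exists a normalized, monotone, submodular set
function `F` on the subsets of a ground set of size `N` whose expected value over a uniformly
random subset of size `M` is at most `(M/N + ε/M)` times the maximum of `F` over subsets of
cardinality at most `M`. -/
theorem exists_bad_submodular_for_random_sampling_eps (N M : ℕ) (hM : 1 ≤ M) (hMN : M ≤ N)
    (ε : ℝ) (hε0 : 0 ≤ ε) (hε1 : ε ≤ 1) :
    ∃ F : Finset (Fin N) → ℝ,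
      -- normalized
      F ∅ = 0 ∧
      -- monotone
      (∀ S T : Finset (Fin N), S ⊆ T → F S ≤ F T) ∧
      -- submodular (diminishing marginal gains)
      (∀ (S T : Finset (Fin N)) (a : Fin N), S ⊆ T → a ∉ T →
        F (insert a T) - F T ≤ F (insert a S) - F S) ∧
      -- the expected value of a uniformly random M-subset is at most (M/N + ε/M) times
      -- the maximum of F over subsets of size at most M
      ∃ Smax : Finset (Fin N), Smax.card ≤ M ∧
        (∀ S : Finset (Fin N), S.card ≤ M → F S ≤ F Smax) ∧
        ((N.choose M : ℝ))⁻¹ *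
            ∑ S ∈ Finset.powersetCard M (Finset.univ : Finset (Fin N)), F S ≤
          ((M : ℝ) / (N : ℝ) + ε / (M : ℝ)) * F Smax := by
  obtain ⟨n, rfl⟩ : ∃ n, N = n + 1 := ⟨N - 1, by omega⟩
  obtain ⟨m, rfl⟩ : ∃ m, M = m + 1 := ⟨M - 1, by omega⟩
  -- the witness is the indicator of containing a fixed element
  refine ⟨fun S => if (0 : Fin (n + 1)) ∈ S then 1 else 0, by simp, ?_, ?_, {0}, by simp, ?_, ?_⟩
  · intro S T hST
    have := @hST 0
    dsimp only
    split_ifs <;> first | (exfalso; tauto) | norm_num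
  · intro S T a hST ha
    have := @hST 0
    simp only [Finset.mem_insert]
    by_cases h0 : (0 : Fin (n + 1)) = a
    · subst h0
      have hS : (0 : Fin (n + 1)) ∉ S := fun h => ha (hST h)
      simp [ha, hS]
    · simp [h0]
  · intro S _
    dsimp only
    split_ifs <;> simp_all
  · have hsum : (∑ S ∈ Finset.powersetCard (m + 1) (Finset.univ : Finset (Fin (n + 1))),
        (if (0 : Fin (n + 1)) ∈ S then (1 : ℝ) else 0)) = (n.choose m : ℝ) := by
      rw [Finset.sum_boole, card_powersetCard_mem_aux]
    have hid : ((n : ℝ) + 1) * (n.choose m : ℝ) =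
        ((n + 1).choose (m + 1) : ℝ) * ((m : ℝ) + 1) := by
      exact_mod_cast Nat.add_one_mul_choose_eq n m
    have hpos : (0 : ℝ) < ((n + 1).choose (m + 1) : ℝ) := by
      exact_mod_cast Nat.choose_pos hMN
    have hn : (0 : ℝ) < (n : ℝ) + 1 := by positivity
    have heq : (((n + 1).choose (m + 1) : ℝ))⁻¹ * (n.choose m : ℝ) =
        ((m + 1 : ℕ) : ℝ) / ((n + 1 : ℕ) : ℝ) := by
      push_cast
      rw [inv_mul_eq_div, div_eq_div_iff hpos.ne' hn.ne']
      linarith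
    have hnn : 0 ≤ ε / ((m + 1 : ℕ) : ℝ) := by positivity
    dsimp only
    rw [hsum, heq, if_pos (Finset.mem_singleton_self _)]
    linarith
end

section
/- Let F be a normalized, monotone, submodular set function on a finite ground set V, let M ≥ 1 be an integer, let α > 0, and let S* maximize F over all subsets of size at most M. Suppose S ⊆ V and b ∈ V satisfy F(S ∪ {b}) − F(S) ≥ α · max_{a ∈ V} (F(S ∪ {a}) − F(S)) − ε for some ε ≥ 0. Then F(S ∪ {b}) − F(S) ≥ (α/M) · (F(S*) − F(S)) − ε. -/
open Finset

/-- helper lemma: if `b` is an `α`-approximate (up to additive `ε`) maximizer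
of the marginal gain given `S`, then its marginal gain is at least
`(α/M)(F(S*) − F(S)) − ε`, where `S*` maximizes `F` over subsets of size at most `M`. -/
theorem approx_greedy_step_gain {V : Type*} [Fintype V] [DecidableEq V] [Nonempty V]
    (F : Finset V → ℝ)
    -- normalized
    (hnorm : F ∅ = 0)
    -- monotone
    (hmono : ∀ S T : Finset V, S ⊆ T → F S ≤ F T)
    -- submodular (diminishing marginal gains)
    (hsub : ∀ (S T : Finset V) (a : V), S ⊆ T → a ∉ T →
      F (insert a T) - F T ≤ F (insert a S) - F S)
    (M : ℕ) (hM : 1 ≤ M) (α : ℝ) (hα : 0 < α)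
    (Sstar : Finset V) (hSstarCard : Sstar.card ≤ M)
    (hSstarOpt : ∀ S : Finset V, S.card ≤ M → F S ≤ F Sstar)
    (S : Finset V) (b : V) (ε : ℝ) (hε : 0 ≤ ε)
    (hb : F (insert b S) - F S ≥
      α * (Finset.univ.sup' Finset.univ_nonempty (fun a : V => F (insert a S) - F S)) - ε) :
    F (insert b S) - F S ≥ (α / (M : ℝ)) * (F Sstar - F S) - ε := by
  have hM0 : (0 : ℝ) < M := by exact_mod_cast hM
  set m := Finset.univ.sup' Finset.univ_nonempty (fun a : V => F (insert a S) - F S) with hm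
  have hle : ∀ a, F (insert a S) - F S ≤ m := fun a =>
    Finset.le_sup' (fun a : V => F (insert a S) - F S) (Finset.mem_univ a)
  have hm0 : 0 ≤ m := by
    have h1 := hle b
    have h2 := hmono S (insert b S) (Finset.subset_insert b S)
    linarith
  have key : ∀ T : Finset V, F (T ∪ S) - F S ≤ T.card * m := by
    intro T
    induction T using Finset.induction_on with
    | empty => simp
    | insert a T ha ih =>
      rw [Finset.insert_union, Finset.card_insert_of_notMem ha]
      push_cast
      by_cases h : a ∈ T ∪ S
      · rw [Finset.insert_eq_of_mem h]
        linarith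
      · have h1 := hsub S (T ∪ S) a Finset.subset_union_right h
        have h2 := hle a
        linarith
  have h1 := key Sstar
  have h2 := hmono Sstar (Sstar ∪ S) Finset.subset_union_left
  have h3 : (Sstar.card : ℝ) * m ≤ M * m :=
    mul_le_mul_of_nonneg_right (by exact_mod_cast hSstarCard) hm0
  have h4 : (α / (M : ℝ)) * (F Sstar - F S) ≤ (α / (M : ℝ)) * (M * m) :=
    mul_le_mul_of_nonneg_left (by linarith) (by positivity)
  have h5 : (α / (M : ℝ)) * (M * m) = α * m := by
    field_simp
  linarith
end

section
/- Let F be a normalized, monotone, submodular set function on a finite ground set V, let M ≥ 1, let 0 < α ≤ 1, and let S* maximize F over subsets of size at most M. Let S⁰ = ∅ and S^{i+1} = S^i ∪ {b^{i+1}}, where each b^{i+1} satisfies F(b^{i+1} | S^i) ≥ α · max_{a ∈ V} F(a | S^i) − ε^{i+1} with ε^{i+1} ≥ 0. Then for every i, F(S*) − F(S^{i+1}) ≤ (1 − α/M) · (F(S*) − F(S^i)) + ε^{i+1}. -/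
open Finset

/-- one-step contraction for the approximate greedy algorithm:
`F(S*) − F(S^{i+1}) ≤ (1 − α/M)(F(S*) − F(S^i)) + ε^{i+1}`. -/
theorem approx_greedy_contraction {V : Type*} [Fintype V] [DecidableEq V] [Nonempty V]
    (F : Finset V → ℝ)
    -- normalized
    (hnorm : F ∅ = 0)
    -- monotone
    (hmono : ∀ S T : Finset V, S ⊆ T → F S ≤ F T)
    -- submodular (diminishing marginal gains)
    (hsub : ∀ (S T : Finset V) (a : V), S ⊆ T → a ∉ T →
      F (insert a T) - F T ≤ F (insert a S) - F S)
    (M : ℕ) (hM : 1 ≤ M) (α : ℝ) (hα0 : 0 < α) (hα1 : α ≤ 1)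
    (Sstar : Finset V) (hSstarCard : Sstar.card ≤ M)
    (hSstarOpt : ∀ S : Finset V, S.card ≤ M → F S ≤ F Sstar)
    (Sseq : ℕ → Finset V) (b : ℕ → V) (ε : ℕ → ℝ)
    (hS0 : Sseq 0 = ∅)
    (hSsucc : ∀ i : ℕ, Sseq (i + 1) = insert (b (i + 1)) (Sseq i))
    (hεnn : ∀ i : ℕ, 0 ≤ ε (i + 1))
    (hb : ∀ i : ℕ, F (insert (b (i + 1)) (Sseq i)) - F (Sseq i) ≥
      α * (Finset.univ.sup' Finset.univ_nonempty
            (fun a : V => F (insert a (Sseq i)) - F (Sseq i))) - ε (i + 1)) :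
    ∀ i : ℕ, F Sstar - F (Sseq (i + 1)) ≤
      (1 - α / (M : ℝ)) * (F Sstar - F (Sseq i)) + ε (i + 1) := by
  intro i
  have hbi := hb i
  rw [← hSsucc i] at hbi
  set S := Sseq i with hS
  set m := Finset.univ.sup' Finset.univ_nonempty
            (fun a : V => F (insert a S) - F S) with hm
  have hle : ∀ a : V, F (insert a S) - F S ≤ m := fun a =>
    Finset.le_sup' (fun a : V => F (insert a S) - F S) (Finset.mem_univ a)
  have hm0 : 0 ≤ m := by
    have h1 := hle (b 0)
    have h2 := hmono S (insert (b 0) S) (Finset.subset_insert _ _)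
    linarith
  have key : ∀ T : Finset V, F (T ∪ S) - F S ≤ (T.card : ℝ) * m := by
    intro T
    induction T using Finset.induction_on with
    | empty => simp
    | insert a T ha ih =>
      rw [Finset.insert_union, Finset.card_insert_of_notMem ha]
      push_cast
      by_cases h : a ∈ T ∪ S
      · rw [Finset.insert_eq_of_mem h]
        linarith
      · have h1 := hsub S (T ∪ S) a Finset.subset_union_right h
        have h2 := hle a
        linarith
  have h1 := key Sstar
  have h2 := hmono Sstar (Sstar ∪ S) Finset.subset_union_left
  have h3 : (Sstar.card : ℝ) * m ≤ (M : ℝ) * m :=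
    mul_le_mul_of_nonneg_right (by exact_mod_cast hSstarCard) hm0
  have hMpos : (0 : ℝ) < M := by exact_mod_cast hM
  have h4 : α / (M : ℝ) * (F Sstar - F S) ≤ α / (M : ℝ) * ((M : ℝ) * m) :=
    mul_le_mul_of_nonneg_left (by linarith) (by positivity)
  have h5 : α / (M : ℝ) * ((M : ℝ) * m) = α * m := by
    field_simp
  linarith
end

section
/- Let F be a normalized, monotone, submodular set function on a finite ground set V, let M ≥ 1, let 0 < α ≤ 1, and let S* maximize F over subsets of size at most M. Let S⁰ = ∅ and S^{i+1} = S^i ∪ {b^{i+1}}, where each b^{i+1} satisfies F(b^{i+1} | S^i) ≥ α · max_{a ∈ V} F(a | S^i) − ε^{i+1} with ε^{i+1} ≥ 0. Then for every i with 0 ≤ i ≤ M, F(S*) − F(S^i) ≤ (1 − α/M)^i · F(S*) + Σ_{j=1}^{i} ε^j. -/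
open Finset

/-- unrolled recursion for the approximate greedy algorithm:
for `0 ≤ i ≤ M`, `F(S*) − F(S^i) ≤ (1 − α/M)^i F(S*) + Σ_{j=1}^{i} ε^j`. -/
theorem approx_greedy_unrolled {V : Type*} [Fintype V] [DecidableEq V] [Nonempty V]
    (F : Finset V → ℝ)
    -- normalized
    (hnorm : F ∅ = 0)
    -- monotone
    (hmono : ∀ S T : Finset V, S ⊆ T → F S ≤ F T)
    -- submodular (diminishing marginal gains)
    (hsub : ∀ (S T : Finset V) (a : V), S ⊆ T → a ∉ T →
      F (insert a T) - F T ≤ F (insert a S) - F S)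
    (M : ℕ) (hM : 1 ≤ M) (α : ℝ) (hα0 : 0 < α) (hα1 : α ≤ 1)
    (Sstar : Finset V) (hSstarCard : Sstar.card ≤ M)
    (hSstarOpt : ∀ S : Finset V, S.card ≤ M → F S ≤ F Sstar)
    (Sseq : ℕ → Finset V) (b : ℕ → V) (ε : ℕ → ℝ)
    (hS0 : Sseq 0 = ∅)
    (hSsucc : ∀ i : ℕ, Sseq (i + 1) = insert (b (i + 1)) (Sseq i))
    (hεnn : ∀ i : ℕ, 0 ≤ ε (i + 1))
    (hb : ∀ i : ℕ, F (insert (b (i + 1)) (Sseq i)) - F (Sseq i) ≥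
      α * (Finset.univ.sup' Finset.univ_nonempty
            (fun a : V => F (insert a (Sseq i)) - F (Sseq i))) - ε (i + 1)) :
    ∀ i : ℕ, i ≤ M → F Sstar - F (Sseq i) ≤
      (1 - α / (M : ℝ)) ^ i * F Sstar + ∑ j ∈ Finset.Icc 1 i, ε j := by
  have key : ∀ i : ℕ, F Sstar - F (Sseq i) ≤ M * (Finset.univ.sup' Finset.univ_nonempty
      (fun a : V => F (insert a (Sseq i)) - F (Sseq i))) := by
    intro i
    set G := Finset.univ.sup' Finset.univ_nonempty
      (fun a : V => F (insert a (Sseq i)) - F (Sseq i)) with hG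
    have hle : ∀ a : V, F (insert a (Sseq i)) - F (Sseq i) ≤ G := fun a =>
      Finset.le_sup' (fun a : V => F (insert a (Sseq i)) - F (Sseq i)) (Finset.mem_univ a)
    have hG0 : 0 ≤ G := by
      have h1 := hle (b 0)
      have h2 := hmono (Sseq i) (insert (b 0) (Sseq i)) (Finset.subset_insert _ _)
      linarith
    have hT : ∀ T : Finset V, F (T ∪ Sseq i) - F (Sseq i) ≤ T.card * G := by
      intro T
      induction T using Finset.induction_on with
      | empty => simp
      | insert a T ha ih =>
        rw [Finset.card_insert_of_notMem ha, Finset.insert_union]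
        push_cast
        by_cases h : a ∈ T ∪ Sseq i
        · rw [Finset.insert_eq_of_mem h]
          linarith
        · have h1 := hsub (Sseq i) (T ∪ Sseq i) a Finset.subset_union_right h
          have h2 := hle a
          linarith
    have h1 := hT Sstar
    have h2 := hmono Sstar (Sstar ∪ Sseq i) Finset.subset_union_left
    have h3 : (Sstar.card : ℝ) * G ≤ M * G :=
      mul_le_mul_of_nonneg_right (by exact_mod_cast hSstarCard) hG0
    linarith
  have hM' : (1 : ℝ) ≤ M := by exact_mod_cast hM
  have hM0 : (0 : ℝ) < M := by linarith
  have hc0 : 0 ≤ 1 - α / (M : ℝ) := by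
    have : α / (M : ℝ) ≤ 1 := by
      rw [div_le_one hM0]
      linarith
    linarith
  have hq : 0 < α / (M : ℝ) := div_pos hα0 hM0
  intro i
  induction i with
  | zero => intro _; simp [hS0, hnorm]
  | succ i ih =>
    intro hi
    have ih := ih (by omega)
    have h1 := hb i
    have h2 := key i
    rw [← hSsucc i] at h1
    set G := Finset.univ.sup' Finset.univ_nonempty
      (fun a : V => F (insert a (Sseq i)) - F (Sseq i)) with hG
    have hsum : 0 ≤ ∑ j ∈ Finset.Icc 1 i, ε j := by
      apply Finset.sum_nonneg
      intro j hj
      obtain ⟨k, rfl⟩ : ∃ k, j = k + 1 := ⟨j - 1, by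
        have := (Finset.mem_Icc.1 hj).1
        omega⟩
      exact hεnn k
    rw [Finset.sum_Icc_succ_top (by omega), pow_succ]
    have h3 : α / (M : ℝ) * (F Sstar - F (Sseq i)) ≤ α * G := by
      calc α / (M : ℝ) * (F Sstar - F (Sseq i)) ≤ α / (M : ℝ) * (M * G) :=
            mul_le_mul_of_nonneg_left h2 hq.le
        _ = α * G := by field_simp
    have h4 := mul_le_mul_of_nonneg_left ih hc0
    have h5 := mul_nonneg hq.le hsum
    linarith
end

section
/- Let F be a nonnegative, normalized, monotone, submodular set function on a finite ground set V, let M ≥ 1, and let 0 < α ≤ 1. Suppose the approximate greedy algorithm produces S⁰ = ∅ and S^{t} = S^{t−1} ∪ {b^{t}} for t = 1, …, M, where each b^{t} satisfies F(b^{t} | S^{t−1}) ≥ α · max_{a ∈ V} F(a | S^{t−1}) − ε^{t} with ε^{t} ≥ 0. Then F(S^M) ≥ (1 − e^{−α}) · max_{|S| ≤ M} F(S) − Σ_{t=1}^{M} ε^{t}. -/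
open Finset

/-- Lemma 2: the approximate greedy algorithm on a nonnegative, normalized,
monotone submodular function achieves
`F(S^M) ≥ (1 − e^{−α}) max_{|S| ≤ M} F(S) − Σ_{t=1}^{M} ε^t`. -/
theorem approx_greedy_guarantee {V : Type*} [Fintype V] [DecidableEq V] [Nonempty V]
    (F : Finset V → ℝ)
    -- nonnegative
    (hnn : ∀ S : Finset V, 0 ≤ F S)
    -- normalized
    (hnorm : F ∅ = 0)
    -- monotone
    (hmono : ∀ S T : Finset V, S ⊆ T → F S ≤ F T)
    -- submodular (diminishing marginal gains)
    (hsub : ∀ (S T : Finset V) (a : V), S ⊆ T → a ∉ T →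
      F (insert a T) - F T ≤ F (insert a S) - F S)
    (M : ℕ) (hM : 1 ≤ M) (α : ℝ) (hα0 : 0 < α) (hα1 : α ≤ 1)
    (Sstar : Finset V) (hSstarCard : Sstar.card ≤ M)
    (hSstarOpt : ∀ S : Finset V, S.card ≤ M → F S ≤ F Sstar)
    (Sseq : ℕ → Finset V) (b : ℕ → V) (ε : ℕ → ℝ)
    (hS0 : Sseq 0 = ∅)
    (hSsucc : ∀ t : ℕ, t < M → Sseq (t + 1) = insert (b (t + 1)) (Sseq t))
    (hεnn : ∀ t : ℕ, t < M → 0 ≤ ε (t + 1))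
    (hb : ∀ t : ℕ, t < M → F (insert (b (t + 1)) (Sseq t)) - F (Sseq t) ≥
      α * (Finset.univ.sup' Finset.univ_nonempty
            (fun a : V => F (insert a (Sseq t)) - F (Sseq t))) - ε (t + 1)) :
    F (Sseq M) ≥ (1 - Real.exp (-α)) * F Sstar - ∑ t ∈ Finset.Icc 1 M, ε t := by
  have key : ∀ (S : Finset V) (m : ℝ), 0 ≤ m → (∀ a, F (insert a S) - F S ≤ m) →
      ∀ T : Finset V, F (S ∪ T) - F S ≤ (T.card : ℝ) * m := by
    intro S m hm0 hm T
    induction T using Finset.induction_on with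
    | empty => simp
    | insert a T haT ih =>
      rw [Finset.card_insert_of_notMem haT, Finset.union_insert]
      push_cast
      by_cases ha : a ∈ S ∪ T
      · rw [Finset.insert_eq_of_mem ha]
        linarith
      · have h1 := hsub S (S ∪ T) a Finset.subset_union_left ha
        have h2 := hm a
        linarith
  have hMpos : (0 : ℝ) < M := by exact_mod_cast hM
  have hM1 : (1 : ℝ) ≤ M := by exact_mod_cast hM
  have hq1 : α / M ≤ 1 := by
    rw [div_le_one hMpos]
    linarith
  have hq0 : 0 < α / M := by positivity
  have step : ∀ t, t < M → F Sstar - F (Sseq (t + 1)) ≤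
      (1 - α / M) * (F Sstar - F (Sseq t)) + ε (t + 1) := by
    intro t ht
    have h1 := hb t ht
    rw [hSsucc t ht]
    set m := Finset.univ.sup' Finset.univ_nonempty
      (fun a : V => F (insert a (Sseq t)) - F (Sseq t)) with hmdef
    have hm : ∀ a, F (insert a (Sseq t)) - F (Sseq t) ≤ m := fun a =>
      Finset.le_sup' (fun a : V => F (insert a (Sseq t)) - F (Sseq t)) (Finset.mem_univ a)
    have hm0 : 0 ≤ m := by
      have h2 := hm (b (t + 1))
      have h3 := hmono (Sseq t) (insert (b (t + 1)) (Sseq t)) (Finset.subset_insert _ _)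
      linarith
    have h2 := key (Sseq t) m hm0 hm Sstar
    have h3 := hmono Sstar (Sseq t ∪ Sstar) Finset.subset_union_right
    have h4 : (Sstar.card : ℝ) * m ≤ M * m := by gcongr
    have h5 : F Sstar - F (Sseq t) ≤ M * m := by linarith
    have h6 : α / M * (F Sstar - F (Sseq t)) ≤ α / M * (M * m) := by gcongr
    have h7 : α / M * (M * m) = α * m := by field_simp
    linarith
  have main : ∀ t, t ≤ M → F Sstar - F (Sseq t) ≤
      (1 - α / M) ^ t * F Sstar + ∑ i ∈ Finset.Icc 1 t, ε i ∧
      0 ≤ ∑ i ∈ Finset.Icc 1 t, ε i := by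
    intro t
    induction t with
    | zero => intro _; simp [hS0, hnorm]
    | succ t ih =>
      intro ht
      obtain ⟨h1, h0⟩ := ih (by omega)
      have h2 := step t (by omega)
      have h3 := hεnn t (by omega)
      rw [Finset.sum_Icc_succ_top (by omega), pow_succ]
      refine ⟨?_, by linarith⟩
      have h4 := mul_le_mul_of_nonneg_left h1 (sub_nonneg.2 hq1)
      have h5 := mul_nonneg hq0.le h0
      linarith
  have h1 := (main M le_rfl).1
  have h2 : (1 - α / M) ^ M ≤ Real.exp (-α) :=
    Real.one_sub_div_pow_le_exp_neg (by linarith)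
  have h3 := mul_le_mul_of_nonneg_right h2 (hnn Sstar)
  linarith
end

section
/- Let F be a nonnegative, normalized, monotone, submodular set function on a finite ground set V with |V| = N, let 1 ≤ M ≤ N, and let S* maximize F over subsets of size at most M. If a random subset S ⊆ V is formed by including each element of V independently with probability p = M/N, then E[F(S)] ≥ (M/N) · F(V) ≥ (M/N) · F(S*). -/
open Finset

lemma sampling_aux {V : Type*} [DecidableEq V] (F : Finset V → ℝ) (hnorm : F ∅ = 0)
    (hsub : ∀ (S T : Finset V) (a : V), S ⊆ T → a ∉ T →
      F (insert a T) - F T ≤ F (insert a S) - F S)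
    (p : ℝ) (h0 : 0 ≤ p) (h1 : p ≤ 1) (A : Finset V) :
    p * F A ≤ ∑ S ∈ A.powerset, p ^ S.card * (1 - p) ^ (A.card - S.card) * F S := by
  induction A using Finset.induction_on with
  | empty => simp [hnorm]
  | insert a A ha ih =>
    have hw : ∑ S ∈ A.powerset, p ^ S.card * (1 - p) ^ (A.card - S.card) = 1 := by
      rw [Finset.sum_pow_mul_eq_add_pow]; simp
    rw [Finset.sum_powerset_insert ha, ← Finset.sum_add_distrib]
    have key : ∀ S ∈ A.powerset,
        p ^ S.card * (1 - p) ^ (A.card - S.card) * F S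
          + (p ^ S.card * (1 - p) ^ (A.card - S.card)) * (p * (F (insert a A) - F A))
        ≤ p ^ S.card * (1 - p) ^ ((insert a A).card - S.card) * F S
          + p ^ (insert a S).card * (1 - p) ^ ((insert a A).card - (insert a S).card)
            * F (insert a S) := by
      intro S hS
      have hSA := Finset.mem_powerset.1 hS
      have hc := Finset.card_le_card hSA
      have haS : a ∉ S := fun h => ha (hSA h)
      rw [Finset.card_insert_of_notMem ha, Finset.card_insert_of_notMem haS,
        Nat.add_sub_add_right, Nat.sub_add_comm hc, pow_succ, pow_succ]
      have hwn : 0 ≤ p ^ S.card * (1 - p) ^ (A.card - S.card) :=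
        mul_nonneg (pow_nonneg h0 _) (pow_nonneg (by linarith) _)
      have := mul_le_mul_of_nonneg_left
        (mul_le_mul_of_nonneg_left (hsub S A a hSA ha) h0) hwn
      linarith
    have h := Finset.sum_le_sum key
    rw [Finset.sum_add_distrib, ← Finset.sum_mul, hw] at h
    linarith

/-- for a nonnegative, normalized, monotone submodular `F`, sampling each
element independently with probability `p = M/N` gives
`E[F(S)] ≥ (M/N) F(V) ≥ (M/N) F(S*)`. -/
theorem independent_sampling_lower_bound {V : Type*} [Fintype V] [DecidableEq V]
    (F : Finset V → ℝ)
    -- nonnegative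
    (hnn : ∀ S : Finset V, 0 ≤ F S)
    -- normalized
    (hnorm : F ∅ = 0)
    -- monotone
    (hmono : ∀ S T : Finset V, S ⊆ T → F S ≤ F T)
    -- submodular (diminishing marginal gains)
    (hsub : ∀ (S T : Finset V) (a : V), S ⊆ T → a ∉ T →
      F (insert a T) - F T ≤ F (insert a S) - F S)
    (M : ℕ) (hM : 1 ≤ M) (hMN : M ≤ Fintype.card V)
    (Sstar : Finset V) (hSstarCard : Sstar.card ≤ M)
    (hSstarOpt : ∀ S : Finset V, S.card ≤ M → F S ≤ F Sstar)
    (p : ℝ) (hp : p = (M : ℝ) / (Fintype.card V : ℝ)) :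
    -- E[F(S)] ≥ (M/N) · F(V)
    (∑ S ∈ (Finset.univ : Finset V).powerset,
        p ^ S.card * (1 - p) ^ (Fintype.card V - S.card) * F S) ≥
      ((M : ℝ) / (Fintype.card V : ℝ)) * F Finset.univ ∧
    -- (M/N) · F(V) ≥ (M/N) · F(S*)
    ((M : ℝ) / (Fintype.card V : ℝ)) * F Finset.univ ≥
      ((M : ℝ) / (Fintype.card V : ℝ)) * F Sstar := by
  have hN : (0 : ℝ) < Fintype.card V := by
    exact_mod_cast lt_of_lt_of_le hM hMN
  have h0 : 0 ≤ (M : ℝ) / (Fintype.card V : ℝ) := by positivity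
  have h1 : (M : ℝ) / (Fintype.card V : ℝ) ≤ 1 := by
    rw [div_le_one hN]; exact_mod_cast hMN
  subst hp
  refine ⟨?_, mul_le_mul_of_nonneg_left (hmono _ _ (Finset.subset_univ _)) h0⟩
  exact sampling_aux F hnorm hsub _ h0 h1 Finset.univ
end

section
/- Consider the bias-augmented structured SVM objective P₂(w, b) = ‖w‖² + C Σ_{n=1}^{ℓ} max_{y ∈ Y} ( Δ(y^n, y) + ŵ·Ψ̂(x^n, y) − ŵ·Ψ̂(x^n, y^n) ) with ŵ = (w, b) and Ψ̂(x, y) = (Ψ(x, y), 1), where b is not regularized, and the constrained problem P₃ which minimizes the same objective subject to the additional nonnegativity constraints ŵ·Ψ̂(x^n, y) = w·Ψ(x^n, y) + b ≥ 0 for all n = 1, …, ℓ and all y ∈ Y. Then the optimal value of P₃ equals the optimal value of P₂; in particular, enforcing nonnegativity of all scores does not change the achievable regularized hinge loss. -/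
open Finset

/-- Claim 2: adding the nonnegativity constraints
`w·Ψ(xⁿ,y) + b ≥ 0` for all `n` and `y` to the bias-augmented structured SVM does not
change the optimal value: `inf P₃ = inf P₂`. -/
theorem ssvm_nonnegativity_constraint_same_value
    (ℓ d : ℕ) (Y : Type*) [Fintype Y] [Nonempty Y]
    (Δ : Y → Y → ℝ) (hΔnn : ∀ y y' : Y, 0 ≤ Δ y y') (hΔ0 : ∀ y : Y, Δ y y = 0)
    (yn : Fin ℓ → Y) (Ψ : Fin ℓ → Y → Fin d → ℝ) (C : ℝ) (hC : 0 < C) :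
    sInf {v : ℝ | ∃ (w : Fin d → ℝ) (b : ℝ),
        (∀ (n : Fin ℓ) (y : Y), 0 ≤ (∑ i : Fin d, w i * Ψ n y i) + b) ∧
        v = (∑ i : Fin d, (w i) ^ 2) +
          C * ∑ n : Fin ℓ, Finset.univ.sup' Finset.univ_nonempty
            (fun y : Y => Δ (yn n) y +
              ((∑ i : Fin d, w i * Ψ n y i) + b * 1) -
              ((∑ i : Fin d, w i * Ψ n (yn n) i) + b * 1))} =
    sInf {v : ℝ | ∃ (w : Fin d → ℝ) (b : ℝ),
        v = (∑ i : Fin d, (w i) ^ 2) +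
          C * ∑ n : Fin ℓ, Finset.univ.sup' Finset.univ_nonempty
            (fun y : Y => Δ (yn n) y +
              ((∑ i : Fin d, w i * Ψ n y i) + b * 1) -
              ((∑ i : Fin d, w i * Ψ n (yn n) i) + b * 1))} := by
  congr 1
  ext v
  constructor
  · rintro ⟨w, b, -, hv⟩
    exact ⟨w, b, hv⟩
  · rintro ⟨w, b, hv⟩
    refine ⟨w, ∑ n : Fin ℓ, ∑ y : Y, |∑ i : Fin d, w i * Ψ n y i|, ?_, ?_⟩
    · intro n y
      have h1 : |∑ i : Fin d, w i * Ψ n y i| ≤ ∑ y : Y, |∑ i : Fin d, w i * Ψ n y i| :=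
        Finset.single_le_sum (f := fun y : Y => |∑ i : Fin d, w i * Ψ n y i|)
          (fun _ _ => abs_nonneg _) (Finset.mem_univ y)
      have h2 : (∑ y : Y, |∑ i : Fin d, w i * Ψ n y i|) ≤
          ∑ n : Fin ℓ, ∑ y : Y, |∑ i : Fin d, w i * Ψ n y i| :=
        Finset.single_le_sum (f := fun n : Fin ℓ => ∑ y : Y, |∑ i : Fin d, w i * Ψ n y i|)
          (fun _ _ => Finset.sum_nonneg (fun _ _ => abs_nonneg _)) (Finset.mem_univ n)
      have h3 := neg_abs_le (∑ i : Fin d, w i * Ψ n y i)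
      linarith
    · rw [hv]
      congr 2
      refine Finset.sum_congr rfl fun n _ => ?_
      congr 1
      funext y
      ring
end
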